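/- Let 𝒢 be a closed subgroup of Sym(P) containing every permutation of P that preserves the relation Pari, and suppose 𝒢 contains some permutation that does not preserve Pari. Then 𝒢 is 3-transitive: for any two triples (a₁, a₂, a₃) and (b₁, b₂, b₃) of pairwise distinct elements of P there exists g ∈ 𝒢 with g(aᵢ) = bᵢ for i = 1, 2, 3. -/

import Mathlib

variable {P : Type} [PartialOrder P]

/-- `a` and `b` are incomparable elements of the partial order `P`. -/
def Perp (a b : P) : Prop := ¬ a ≤ b ∧ ¬ b ≤ a

/-- `f` is an order-automorphism of `P`. -/
def IsOrderAuto (f : Equiv.Perm P) : Prop := ∀ a b : P, f a ≤ f b ↔ a ≤ b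

/-- `f` is an anti-automorphism of `P`. -/
def IsAntiAuto (f : Equiv.Perm P) : Prop := ∀ a b : P, f a ≤ f b ↔ b ≤ a

/-- Every finite partial order embeds into `P` (universality). -/
def IsUniversal (P : Type) [PartialOrder P] : Prop :=
  ∀ (Q : Type) [PartialOrder Q] [Fintype Q], Nonempty (Q ↪o P)

/-- Every order-isomorphism between two finite subsets of `P` extends to an
order-automorphism of `P` (homogeneity). -/
def IsHomogeneous (P : Type) [PartialOrder P] : Prop :=
  ∀ (S T : Finset P) (e : (S : Set P) ≃o (T : Set P)),
    ∃ g : P ≃o P, ∀ x : (S : Set P), g ↑x = ↑(e x)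

/-- A subgroup of `Sym(P)` is closed iff it contains every permutation that agrees
with one of its members on each finite subset of `P`. -/
def IsClosedSubgroup (G : Subgroup (Equiv.Perm P)) : Prop :=
  ∀ f : Equiv.Perm P,
    (∀ S : Finset P, ∃ g ∈ G, ∀ x ∈ S, (g : Equiv.Perm P) x = f x) → f ∈ G

/-- `h` is an order-automorphism of `P` fixing each of the constants `c i`. -/
def FixingAuto (n : ℕ) (c : Fin n → P) (h : Equiv.Perm P) : Prop :=
  IsOrderAuto h ∧ ∀ i : Fin n, h (c i) = c i

/-- `X` is an orbit of `(P, c₁, …, cₙ)`, i.e. an orbit of the action on `P` of the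
group of automorphisms of `P` fixing each `c i`. -/
def IsOrbit (n : ℕ) (c : Fin n → P) (X : Set P) : Prop :=
  ∃ x : P, X = {y | ∃ h : Equiv.Perm P, FixingAuto n c h ∧ h x = y}

/-- `g` is canonical as a function from `(P, c₁, …, cₙ)` to `P`. -/
def Canonical (n : ℕ) (c : Fin n → P) (g : P → P) : Prop :=
  ∀ (m : ℕ) (a b : Fin m → P),
    (∃ h : Equiv.Perm P, FixingAuto n c h ∧ ∀ j : Fin m, h (a j) = b j) →
    ∃ h' : Equiv.Perm P, IsOrderAuto h' ∧ ∀ j : Fin m, h' (g (a j)) = g (b j)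

/-- `g` is M-generated by the subgroup `G` of `Sym(P)`: on every finite subset of `P`
it agrees with some member of `G`. -/
def MGen (G : Subgroup (Equiv.Perm P)) (g : P → P) : Prop :=
  ∀ S : Finset P, ∃ h ∈ G, ∀ x ∈ S, (h : Equiv.Perm P) x = g x

/-- `g` behaves like `id` on `X`. -/
def BehavesLikeId (g : P → P) (X : Set P) : Prop :=
  ∀ x ∈ X, ∀ x' ∈ X, (x < x' → g x < g x') ∧ (Perp x x' → Perp (g x) (g x'))

/-- `g` behaves like `↕` on `X`. -/
def BehavesLikeRev (g : P → P) (X : Set P) : Prop :=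
  ∀ x ∈ X, ∀ x' ∈ X, (x < x' → g x' < g x) ∧ (Perp x x' → Perp (g x) (g x'))

/-- `g` behaves like `id` between `X` and `Y`. -/
def BehavesLikeIdBetween (g : P → P) (X Y : Set P) : Prop :=
  ∀ x ∈ X, ∀ y ∈ Y,
    (x < y → g x < g y) ∧ (y < x → g y < g x) ∧ (Perp x y → Perp (g x) (g y))

/-- `X ≤ Y` for subsets: some element of `X` lies below some element of `Y`. -/
def SetLE (X Y : Set P) : Prop := ∃ x ∈ X, ∃ y ∈ Y, x ≤ y

/-- `X < Y` for subsets: every element of `X` lies strictly below every element of `Y`. -/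
def SetLT (X Y : Set P) : Prop := ∀ x ∈ X, ∀ y ∈ Y, x < y

/-- The relation `X ÷ Y`. -/
def SetDiv (X Y : Set P) : Prop :=
  (SetLE X Y ∧ ¬ SetLE Y X ∧ ¬ SetLT X Y) ∨ (SetLE Y X ∧ ¬ SetLE X Y ∧ ¬ SetLT Y X)

/-- `f` is a rotation of `P`. -/
def IsRotation (f : Equiv.Perm P) : Prop :=
  ∃ X Y Z : Set P,
    (∀ p : P, p ∈ X ∨ p ∈ Y ∨ p ∈ Z) ∧
    Disjoint X Y ∧ Disjoint X Z ∧ Disjoint Y Z ∧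
    IsLowerSet X ∧ IsUpperSet Z ∧
    (∀ x ∈ X, ∀ z ∈ Z, x < z) ∧
    BehavesLikeId (⇑f) X ∧ BehavesLikeId (⇑f) Y ∧ BehavesLikeId (⇑f) Z ∧
    (∀ x ∈ X, ∀ z ∈ Z, f z < f x) ∧
    (∀ x ∈ X, ∀ y ∈ Y, (f y < f x ↔ Perp x y) ∧ (Perp (f x) (f y) ↔ x < y)) ∧
    (∀ y ∈ Y, ∀ z ∈ Z, (f z < f y ↔ Perp y z) ∧ (Perp (f y) (f z) ↔ y < z))

/-- The ternary relation `Cyc`. -/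
def Cyc (a b c : P) : Prop :=
  (a < b ∧ b < c) ∨ (b < c ∧ c < a) ∨ (c < a ∧ a < b) ∨
  (a < b ∧ Perp c a ∧ Perp c b) ∨ (b < c ∧ Perp a b ∧ Perp a c) ∨
  (c < a ∧ Perp b a ∧ Perp b c)

/-- The ternary relation `Cyc'`, the dual of `Cyc`. -/
def Cyc' (a b c : P) : Prop := Cyc c b a

/-- The ternary relation `Pari`. -/
def Pari (a b c : P) : Prop :=
  (Perp a b ∧ Perp b c ∧ Perp a c) ∨
  (a < b ∧ a < c ∧ Perp b c) ∨ (b < a ∧ b < c ∧ Perp a c) ∨ (c < a ∧ c < b ∧ Perp a b) ∨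
  (b < a ∧ c < a ∧ Perp b c) ∨ (a < b ∧ c < b ∧ Perp a c) ∨ (a < c ∧ b < c ∧ Perp a b)

/-- `f` preserves the ternary relation `R`. -/
def Preserves3 (f : P → P) (R : P → P → P → Prop) : Prop :=
  ∀ a b c : P, R a b c ↔ R (f a) (f b) (f c)

/-- Homogeneity for finite families: two families with the same order type are conjugate under
an order-automorphism. -/
lemma IsHomogeneous.exists_orderIso (hH : IsHomogeneous P) {ι : Type*} [Finite ι] (s t : ι → P)
    (h : ∀ i j, s i ≤ s j ↔ t i ≤ t j) : ∃ g : P ≃o P, ∀ i, g (s i) = t i := by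
  classical
  cases nonempty_fintype ι
  have hS : ∀ x : ((Finset.univ.image s : Finset P) : Set P), ∃ i, s i = x := fun x => by
    simpa using x.2
  choose k hk using hS
  let φ : ((Finset.univ.image s : Finset P) : Set P) ↪o ((Finset.univ.image t : Finset P) : Set P) :=
    OrderEmbedding.ofMapLEIff (fun x => ⟨t (k x), by simp⟩) (fun x y => by
      change t (k x) ≤ t (k y) ↔ (x : P) ≤ y
      rw [← h, hk, hk])
  have key : ∀ i (hi : s i ∈ ((Finset.univ.image s : Finset P) : Set P)),
      t (k ⟨s i, hi⟩) = t i := fun i hi => by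
    have := hk ⟨s i, hi⟩
    exact le_antisymm ((h _ _).1 this.le) ((h _ _).1 this.ge)
  have hφ : Function.Surjective φ := by
    rintro ⟨y, hy⟩
    obtain ⟨i, rfl⟩ : ∃ i, t i = y := by simpa using hy
    exact ⟨⟨s i, by simp⟩, Subtype.ext (key i _)⟩
  obtain ⟨g, hg⟩ := hH _ _ (RelIso.ofSurjective φ hφ)
  exact ⟨g, fun i => (hg ⟨s i, by simp⟩).trans (key i _)⟩

/-- A type with one additional point. -/
inductive OnePointExtension (α : Type)
  | new : OnePointExtension α
  | old : α → OnePointExtension α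

open OnePointExtension

instance {α : Type} [Fintype α] : Fintype (OnePointExtension α) :=
  Fintype.ofEquiv (Option α)
    { toFun x := x.elim new old
      invFun
        | new => none
        | old x => some x
      left_inv x := by cases x <;> rfl
      right_inv x := by cases x <;> rfl }

/-- The order on a poset with one additional point `new` lying above `L` and below `U`. -/
@[reducible] def onePointOrder {α : Type} [PartialOrder α] (L U : α → Prop)
    (hL : ∀ x y, x ≤ y → L y → L x) (hU : ∀ x y, x ≤ y → U x → U y)
    (hLU : ∀ x y, L x → U y → x < y) : PartialOrder (OnePointExtension α) where
  le x y := match x, y with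
    | new, new => True
    | old x, new => L x
    | new, old y => U y
    | old x, old y => x ≤ y
  le_refl x := by cases x <;> simp
  le_trans x y z := by
    rcases x with _ | x <;> rcases y with _ | y <;> rcases z with _ | z <;> simp only
    all_goals grind
  le_antisymm x y := by
    rcases x with _ | x <;> rcases y with _ | y <;> simp only
    all_goals grind

/-- The one-point extension property of the random partial order. -/
lemma exists_point_between (hU : IsUniversal P) (hH : IsHomogeneous P) {ι : Type*} (S : Finset ι)
    (b : ι → P) (L U : ι → Prop) (hLow : ∀ i ∈ S, ∀ j ∈ S, b i ≤ b j → L j → L i)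
    (hUp : ∀ i ∈ S, ∀ j ∈ S, b i ≤ b j → U i → U j)
    (hLU : ∀ i ∈ S, ∀ j ∈ S, L i → U j → b i < b j) :
    ∃ p, ∀ i ∈ S, (b i ≤ p ↔ L i) ∧ (p ≤ b i ↔ U i) := by
  classical
  let T := S.image b
  let L' : T → Prop := fun x => ∃ i ∈ S, b i = x ∧ L i
  let U' : T → Prop := fun x => ∃ i ∈ S, b i = x ∧ U i
  have hT : ∀ x : T, ∃ i ∈ S, b i = x := fun x => Finset.mem_image.1 x.2
  let : PartialOrder (OnePointExtension T) := onePointOrder L' U'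
    (by
      rintro x y hxy ⟨j, hj, hjy, hLj⟩
      obtain ⟨i, hi, hix⟩ := hT x
      exact ⟨i, hi, hix, hLow i hi j hj (by rw [hix, hjy]; exact hxy) hLj⟩)
    (by
      rintro x y hxy ⟨i, hi, hix, hUi⟩
      obtain ⟨j, hj, hjy⟩ := hT y
      exact ⟨j, hj, hjy, hUp i hi j hj (by rw [hix, hjy]; exact hxy) hUi⟩)
    (by
      rintro x y ⟨i, hi, hix, hLi⟩ ⟨j, hj, hjy, hUj⟩
      have := hLU i hi j hj hLi hUj
      rw [hix, hjy] at this
      exact this)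
  obtain ⟨e⟩ := hU (OnePointExtension T)
  obtain ⟨g, hg⟩ := hH.exists_orderIso (fun x : T => (x : P)) (fun x => e (old x))
    (fun x y => by rw [e.le_iff_le]; rfl)
  refine ⟨g.symm (e new), fun i hi => ?_⟩
  have hgi := hg ⟨b i, Finset.mem_image_of_mem b hi⟩
  rw [g.le_symm_apply, g.symm_apply_le, hgi, e.le_iff_le, e.le_iff_le]
  constructor
  · exact ⟨fun ⟨j, hj, hji, hLj⟩ => hLow i hi j hj hji.ge hLj, fun h => ⟨i, hi, rfl, h⟩⟩
  · exact ⟨fun ⟨j, hj, hji, hUj⟩ => hUp j hj i hi hji.le hUj, fun h => ⟨i, hi, rfl, h⟩⟩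

/-- A triple `(x, y, ε)` records that `y` is the image of `x` under a rotation, where `ε` tells
whether `x` belongs to the rotated upper set. Two such records are compatible if their order
relations are as prescribed by the rotation. -/
def RotCompat (p q : P × P × Bool) : Prop :=
  (p.2.2 = q.2.2 → (p.1 ≤ q.1 ↔ p.2.1 ≤ q.2.1)) ∧
  (p.2.2 = false → q.2.2 = true →
    ¬ q.1 ≤ p.1 ∧ ¬ p.2.1 ≤ q.2.1 ∧ (p.1 ≤ q.1 ↔ ¬ q.2.1 ≤ p.2.1))

/-- A finite set of pairwise compatible records: a finite partial rotation. -/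
def IsPartialRot (S : Finset (P × P × Bool)) : Prop := ∀ p ∈ S, ∀ q ∈ S, RotCompat p q

/-- Exchange the roles of a rotation and its inverse. -/
def swapRecord : P × P × Bool ≃ P × P × Bool where
  toFun p := (p.2.1, p.1, !p.2.2)
  invFun p := (p.2.1, p.1, !p.2.2)
  left_inv p := by simp
  right_inv p := by simp

lemma RotCompat.swap {p q : P × P × Bool} (h : RotCompat p q) (h' : RotCompat q p) :
    RotCompat (swapRecord p) (swapRecord q) := by
  obtain ⟨x, y, ε⟩ := p
  obtain ⟨x', y', ε'⟩ := q
  simp only [RotCompat, swapRecord, Equiv.coe_fn_mk] at *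
  cases ε <;> cases ε' <;> simp_all

lemma IsPartialRot.swap {S : Finset (P × P × Bool)} (h : IsPartialRot S) :
    IsPartialRot (S.map swapRecord.toEmbedding) := by
  intro p hp q hq
  obtain ⟨p', hp', rfl⟩ := Finset.mem_map.1 hp
  obtain ⟨q', hq', rfl⟩ := Finset.mem_map.1 hq
  exact (h p' hp' q' hq').swap (h q' hq' p' hp')

open Classical in
/-- A finite partial rotation extends to any new point, on any admissible side. -/
lemma IsPartialRot.exists_insert (hU : IsUniversal P) (hH : IsHomogeneous P)
    {S : Finset (P × P × Bool)} (h : IsPartialRot S) (x : P) (ε : Bool)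
    (h₁ : ∀ p ∈ S, ε = false → p.2.2 = true → ¬ p.1 ≤ x)
    (h₂ : ∀ p ∈ S, ε = true → p.2.2 = false → ¬ x ≤ p.1) :
    ∃ y, IsPartialRot (insert (x, y, ε) S) := by
  by_cases hx : ∃ p ∈ S, p.1 = x
  · obtain ⟨⟨x, y, ε'⟩, hp, rfl⟩ := hx
    have : ε = ε' := by
      have a₁ := h₁ _ hp
      have a₂ := h₂ _ hp
      cases ε <;> cases ε' <;> simp_all
    subst this
    exact ⟨y, by rwa [Finset.insert_eq_of_mem hp]⟩
  push Not at hx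
  obtain ⟨y, hy⟩ := exists_point_between hU hH S (fun p => p.2.1)
    (fun p => (p.2.2 = ε ∧ p.1 ≤ x) ∨ (p.2.2 = true ∧ ε = false ∧ ¬ x ≤ p.1))
    (fun p => (p.2.2 = ε ∧ x ≤ p.1) ∨ (p.2.2 = false ∧ ε = true ∧ ¬ p.1 ≤ x))
    (by
      intro p hp q hq
      have a₁ := h p hp q hq
      have a₂ := h q hq p hp
      simp only [RotCompat] at a₁ a₂
      cases hp₂ : p.2.2 <;> cases hq₂ : q.2.2 <;> cases ε <;> grind)
    (by
      intro p hp q hq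
      have a₁ := h p hp q hq
      have a₂ := h q hq p hp
      simp only [RotCompat] at a₁ a₂
      cases hp₂ : p.2.2 <;> cases hq₂ : q.2.2 <;> cases ε <;> grind)
    (by
      intro p hp q hq
      have a₁ := h p hp q hq
      have a₂ := h q hq p hp
      have a₃ := hx p hp
      have a₄ := hx q hq
      simp only [RotCompat] at a₁ a₂
      rw [lt_iff_le_not_ge]
      cases hp₂ : p.2.2 <;> cases hq₂ : q.2.2 <;> cases ε <;> grind)
  refine ⟨y, ?_⟩
  have key : ∀ p ∈ S, RotCompat p (x, y, ε) ∧ RotCompat (x, y, ε) p := by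
    intro p hp
    have a₁ := hy p hp
    have a₂ := h₁ p hp
    have a₃ := h₂ p hp
    simp only [RotCompat]
    grind
  intro p hp q hq
  rcases Finset.mem_insert.1 hp with rfl | hp <;> rcases Finset.mem_insert.1 hq with rfl | hq
  · simp [RotCompat]
  · exact (key q hq).2
  · exact (key p hp).1
  · exact h p hp q hq

lemma IsPartialRot.exists_extend_dom (hU : IsUniversal P) (hH : IsHomogeneous P)
    {S : Finset (P × P × Bool)} (h : IsPartialRot S) (x : P) :
    ∃ T, S ⊆ T ∧ IsPartialRot T ∧ ∃ p ∈ T, p.1 = x := by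
  classical
  obtain ⟨y, hy⟩ := h.exists_insert hU hH x (decide (∃ p ∈ S, p.2.2 = true ∧ p.1 ≤ x))
    (by
      intro p hp h₁ h₂ h₃
      exact of_decide_eq_false h₁ ⟨p, hp, h₂, h₃⟩)
    (by
      intro p hp h₁ h₂ h₃
      obtain ⟨q, hq, hq₁, hq₂⟩ := of_decide_eq_true h₁
      exact ((h p hp q hq).2 h₂ hq₁).1 (hq₂.trans h₃))
  exact ⟨_, Finset.subset_insert _ _, hy, _, Finset.mem_insert_self _ _, rfl⟩

lemma IsPartialRot.exists_extend_range (hU : IsUniversal P) (hH : IsHomogeneous P)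
    {S : Finset (P × P × Bool)} (h : IsPartialRot S) (y : P) :
    ∃ T, S ⊆ T ∧ IsPartialRot T ∧ ∃ p ∈ T, p.2.1 = y := by
  obtain ⟨T, hST, hT, p, hp, hpy⟩ := h.swap.exists_extend_dom hU hH y
  refine ⟨_, ?_, hT.swap, swapRecord p, Finset.mem_map_of_mem _ hp, hpy⟩
  intro q hq
  exact Finset.mem_map.2 ⟨swapRecord q, hST (Finset.mem_map_of_mem _ hq),
    swapRecord.left_inv q⟩

/-- Back and forth: a finite partial rotation extends to a permutation of `P`. -/
lemma IsPartialRot.exists_perm [Countable P] (hU : IsUniversal P) (hH : IsHomogeneous P)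
    {S : Finset (P × P × Bool)} (h : IsPartialRot S) :
    ∃ (f : Equiv.Perm P) (F : P → Bool), (∀ p ∈ S, f p.1 = p.2.1 ∧ F p.1 = p.2.2) ∧
      ∀ x y, RotCompat (x, f x, F x) (y, f y, F y) := by
  have : Encodable P := Encodable.ofCountable P
  let D : P ⊕ P → Order.Cofinal {S : Finset (P × P × Bool) // IsPartialRot S} := fun i =>
    { carrier := {T | ∃ p ∈ T.1, Sum.elim (fun x => p.1 = x) (fun y => p.2.1 = y) i}
      isCofinal := by
        rintro ⟨T, hT⟩
        rcases i with x | y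
        · obtain ⟨T', hTT', hT', hx⟩ := hT.exists_extend_dom hU hH x
          exact ⟨⟨T', hT'⟩, hx, hTT'⟩
        · obtain ⟨T', hTT', hT', hy⟩ := hT.exists_extend_range hU hH y
          exact ⟨⟨T', hT'⟩, hy, hTT'⟩ }
  let I := Order.idealOfCofinals ⟨S, h⟩ D
  let W : Set (P × P × Bool) := {p | ∃ T ∈ I, p ∈ T.1}
  have hSW : ∀ p ∈ S, p ∈ W := fun p hp => ⟨_, Order.mem_idealOfCofinals _ _, hp⟩
  have hW : ∀ p ∈ W, ∀ q ∈ W, RotCompat p q := by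
    rintro p ⟨T, hT, hp⟩ q ⟨T', hT', hq⟩
    obtain ⟨T'', -, h₁, h₂⟩ := I.directed T hT T' hT'
    exact T''.2 p (h₁ hp) q (h₂ hq)
  have hdom : ∀ x, ∃ y ε, (x, y, ε) ∈ W := by
    intro x
    obtain ⟨T, ⟨⟨_, y, ε⟩, hp, rfl⟩, hT⟩ :=
      Order.cofinal_meets_idealOfCofinals ⟨S, h⟩ D (Sum.inl x)
    exact ⟨y, ε, T, hT, hp⟩
  have hrange : ∀ y, ∃ x ε, (x, y, ε) ∈ W := by
    intro y
    obtain ⟨T, ⟨⟨x, _, ε⟩, hp, rfl⟩, hT⟩ :=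
      Order.cofinal_meets_idealOfCofinals ⟨S, h⟩ D (Sum.inr y)
    exact ⟨x, ε, T, hT, hp⟩
  have huniq : ∀ p ∈ W, ∀ q ∈ W, (p.1 = q.1 ∨ p.2.1 = q.2.1) → p = q := by
    rintro ⟨x, y, ε⟩ hp ⟨x', y', ε'⟩ hq
    have a₁ := hW _ hp _ hq
    have a₂ := hW _ hq _ hp
    simp only [RotCompat] at a₁ a₂
    simp only [Prod.mk.injEq]
    cases ε <;> cases ε' <;> grind
  choose f F hf using hdom
  have hbij : Function.Bijective f := by
    constructor
    · intro x y hxy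
      exact congrArg Prod.fst (huniq _ (hf x) _ (hf y) (Or.inr hxy))
    · intro y
      obtain ⟨x, ε, hx⟩ := hrange y
      exact ⟨x, congrArg (fun p => p.2.1) (huniq _ (hf x) _ hx (Or.inl rfl))⟩
  refine ⟨Equiv.ofBijective f hbij, F, fun p hp => ?_, fun x y => hW _ (hf x) _ (hf y)⟩
  have := huniq _ (hf p.1) _ (hSW p hp) (Or.inl rfl)
  exact ⟨congrArg (fun p => p.2.1) this, congrArg (fun p => p.2.2) this⟩

/-- `Pari` is the two-graph of the incomparability relation. -/
lemma pari_iff (a b c : P) : Pari a b c ↔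
    a ≠ b ∧ b ≠ c ∧ a ≠ c ∧ (Perp a b ↔ (Perp b c ↔ Perp a c)) := by
  simp only [Pari, Perp, lt_iff_le_not_ge]
  by_cases a ≤ b <;> by_cases b ≤ a <;> by_cases b ≤ c <;> by_cases c ≤ b <;> grind

lemma perp_iff_of_rotCompat {p q : P × P × Bool} (h : RotCompat p q) (h' : RotCompat q p) :
    Perp p.2.1 q.2.1 ↔ (Perp p.1 q.1 ↔ p.2.2 = q.2.2) := by
  obtain ⟨x, y, ε⟩ := p
  obtain ⟨x', y', ε'⟩ := q
  simp only [RotCompat, Perp] at *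
  cases ε <;> cases ε' <;> grind

lemma preserves3_pari_of_rotCompat {f : Equiv.Perm P} {F : P → Bool}
    (h : ∀ x y, RotCompat (x, f x, F x) (y, f y, F y)) : Preserves3 (⇑f) Pari := by
  intro a b c
  have key : ∀ x y, Perp (f x) (f y) ↔ (Perp x y ↔ F x = F y) := fun x y =>
    perp_iff_of_rotCompat (h x y) (h y x)
  rw [pari_iff, pari_iff, key, key, key, f.injective.ne_iff, f.injective.ne_iff,
    f.injective.ne_iff]
  cases F a <;> cases F b <;> cases F c <;> simp <;> tauto

/-- Any upper set of a finite subset of `P` can be rotated by a permutation preserving `Pari`. -/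
lemma exists_rotation [Countable P] (hU : IsUniversal P) (hH : IsHomogeneous P) (S : Finset P)
    (F : P → Bool) (hF : ∀ x y, x ≤ y → F x = true → F y = true) :
    ∃ f : Equiv.Perm P, Preserves3 (⇑f) Pari ∧
      ∀ x ∈ S, ∀ y ∈ S, RotCompat (x, f x, F x) (y, f y, F y) := by
  classical
  have : ∃ T : Finset (P × P × Bool), IsPartialRot T ∧ (∀ p ∈ T, F p.1 = p.2.2) ∧
      ∀ x ∈ S, ∃ p ∈ T, p.1 = x := by
    induction S using Finset.induction_on with
    | empty => exact ⟨∅, by simp [IsPartialRot]⟩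
    | insert x S _ ih =>
      obtain ⟨T, hT, hTF, hTS⟩ := ih
      obtain ⟨y, hy⟩ := hT.exists_insert hU hH x (F x) (by grind) (by grind)
      refine ⟨_, hy, ?_, ?_⟩
      · simpa using hTF
      · intro z hz
        rcases Finset.mem_insert.1 hz with rfl | hz
        · exact ⟨_, Finset.mem_insert_self _ _, rfl⟩
        · obtain ⟨p, hp, rfl⟩ := hTS z hz
          exact ⟨p, Finset.mem_insert_of_mem hp, rfl⟩
  obtain ⟨T, hT, hTF, hTS⟩ := this
  obtain ⟨f, F', hf, hF'⟩ := hT.exists_perm hU hH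
  refine ⟨f, preserves3_pari_of_rotCompat hF', fun x hx y hy => ?_⟩
  obtain ⟨p, hp, rfl⟩ := hTS x hx
  obtain ⟨q, hq, rfl⟩ := hTS y hy
  rw [hTF p hp, hTF q hq, ← (hf p hp).2, ← (hf q hq).2]
  exact hF' _ _

/-- Any element can be made incomparable to any two others by a permutation preserving `Pari`. -/
lemma exists_perp_image [Countable P] (hU : IsUniversal P) (hH : IsHomogeneous P) {a b c : P}
    (hac : a ≠ c) (hbc : b ≠ c) :
    ∃ f : Equiv.Perm P, Preserves3 (⇑f) Pari ∧ Perp (f a) (f c) ∧ Perp (f b) (f c) := by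
  classical
  obtain ⟨f, hfP, hf⟩ := exists_rotation hU hH {a, b, c} (fun x => decide (c ≤ x))
    (by simpa using fun x y hxy hcx => le_trans hcx hxy)
  have hfc : ∀ x ∈ ({a, b} : Finset P), x ≠ c → ¬ f x ≤ f c := by
    intro x hx hxc
    have a₁ := hf x (by grind) c (by simp)
    have a₂ := hf c (by simp) x (by grind)
    simp only [RotCompat] at a₁ a₂
    grind
  have hfa := hfc a (by simp) hac
  have hfb := hfc b (by simp) hbc
  obtain ⟨g, hgP, hg⟩ := exists_rotation hU hH {f a, f b, f c} (fun x => decide (f c < x))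
    (by simpa using fun x y hxy hcx => lt_of_lt_of_le hcx hxy)
  have hgc : ∀ x ∈ ({f a, f b} : Finset P), ¬ x ≤ f c → Perp (g x) (g (f c)) := by
    intro x hx hxc
    have a₁ := perp_iff_of_rotCompat (hg x (by grind) (f c) (by simp))
      (hg (f c) (by simp) x (by grind))
    simp only [Perp, lt_iff_le_not_ge] at a₁ ⊢
    grind
  refine ⟨f.trans g, fun x y z => (hfP x y z).trans (hgP _ _ _), ?_, ?_⟩
  · exact hgc _ (by simp) hfa
  · exact hgc _ (by simp) hfb

/-- A triple `(a, b, c)` in which `c` is incomparable to the other two. -/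
def IsNormalTriple (t : Fin 3 → P) : Prop := Perp (t 0) (t 2) ∧ Perp (t 1) (t 2) ∧ t 0 ≠ t 1

/-- A closed group strictly above the group of `Pari`-preserving permutations is
3-transitive. -/
theorem closed_group_above_max_is_3transitive [Countable P] [Infinite P]
    (hU : IsUniversal P) (hH : IsHomogeneous P)
    (G : Subgroup (Equiv.Perm P)) (hG : IsClosedSubgroup G)
    (hPar : ∀ f : Equiv.Perm P, Preserves3 (⇑f) Pari → f ∈ G)
    (hne : ∃ f ∈ G, ¬ Preserves3 (⇑(f : Equiv.Perm P)) Pari) :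
    ∀ a b : Fin 3 → P, Function.Injective a → Function.Injective b →
      ∃ g ∈ G, ∀ i : Fin 3, (g : Equiv.Perm P) (a i) = b i := by
  have hauto : ∀ s t : Fin 3 → P, IsNormalTriple s → IsNormalTriple t →
      (s 0 ≤ s 1 ↔ t 0 ≤ t 1) → (s 1 ≤ s 0 ↔ t 1 ≤ t 0) → ∃ g ∈ G, ∀ i, g (s i) = t i := by
    rintro s t ⟨hs₀, hs₁, hs⟩ ⟨ht₀, ht₁, ht⟩ h₀ h₁
    obtain ⟨g, hg⟩ := hH.exists_orderIso s t (by
      simp only [Perp] at *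
      intro i j
      fin_cases i <;> fin_cases j <;> simp_all)
    refine ⟨g.toEquiv, hPar _ fun a b c => ?_, hg⟩
    simp [Pari, Perp]
  have hnorm : ∀ s : Fin 3 → P, Function.Injective s → ∃ g ∈ G, IsNormalTriple (fun i => g (s i)) ∧
      (Pari (s 0) (s 1) (s 2) ↔ Perp (g (s 0)) (g (s 1))) := by
    intro s hs
    obtain ⟨f, hf, h₀, h₁⟩ := exists_perp_image hU hH (hs.ne (by decide : (0 : Fin 3) ≠ 2))
      (hs.ne (by decide : (1 : Fin 3) ≠ 2))
    refine ⟨f, hPar f hf, ⟨h₀, h₁, f.injective.ne (hs.ne (by decide))⟩, ?_⟩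
    rw [hf, pari_iff]
    have e : ∀ i j : Fin 3, i ≠ j → f (s i) ≠ f (s j) := fun i j h => f.injective.ne (hs.ne h)
    simp [h₀, h₁, e]
  have hswap : ∀ s : Fin 3 → P, IsNormalTriple s →
      IsNormalTriple (s ∘ Equiv.swap 0 1) := fun s ⟨h₀, h₁, h⟩ => ⟨h₁, h₀, h.symm⟩
  obtain ⟨s, hs, k, hk, hks⟩ : ∃ s : Fin 3 → P, Pari (s 0) (s 1) (s 2) ∧
      ∃ k ∈ G, ¬ Pari (k (s 0)) (k (s 1)) (k (s 2)) := by
    obtain ⟨f, hf, hfP⟩ := hne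
    simp only [Preserves3, not_forall] at hfP
    obtain ⟨a, b, c, habc⟩ := hfP
    by_cases h : Pari a b c
    · exact ⟨![a, b, c], h, f, hf, fun h' => habc (iff_of_true h h')⟩
    · refine ⟨![f a, f b, f c], by simpa using not_imp_comm.1 (iff_of_false h) habc, f⁻¹,
        G.inv_mem hf, by simpa using h⟩
  have hsinj : Function.Injective s := by
    obtain ⟨h₀, h₁, h₂, -⟩ := (pari_iff _ _ _).1 hs
    intro i j
    fin_cases i <;> fin_cases j <;> simp [h₀, h₁, h₂, h₀.symm, h₁.symm, h₂.symm]
  obtain ⟨g, hg, hu, hPu⟩ := hnorm s hsinj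
  obtain ⟨g', hg', hv, hPv⟩ := hnorm (fun i => k (s i)) (k.injective.comp hsinj)
  have huv : ∀ i, (g' * k * g⁻¹) (g (s i)) = g' (k (s i)) := fun i => by simp
  have hmem : g' * k * g⁻¹ ∈ G := G.mul_mem (G.mul_mem hg' hk) (G.inv_mem hg)
  replace hPu := hPu.1 hs
  replace hPv := (not_congr hPv).1 hks
  generalize g' * k * g⁻¹ = l at huv hmem
  generalize hu_def : (fun i => g (s i)) = u at hu
  generalize hv_def : (fun i => g' (k (s i))) = v at hv
  replace huv : ∀ i, l (u i) = v i := by subst hu_def hv_def; exact huv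
  replace hPu : Perp (u 0) (u 1) := by subst hu_def; exact hPu
  replace hPv : ¬ Perp (v 0) (v 1) := by subst hv_def; exact hPv
  have hall : ∀ w : Fin 3 → P, IsNormalTriple w → ∃ g ∈ G, ∀ i, g (w i) = u i := by
    intro w hw
    by_cases hPw : Perp (w 0) (w 1)
    · exact hauto w u hw hu (iff_of_false hPw.1 hPu.1) (iff_of_false hPw.2 hPu.2)
    have hcases : ((w 0 ≤ w 1 ↔ v 0 ≤ v 1) ∧ (w 1 ≤ w 0 ↔ v 1 ≤ v 0)) ∨
        ((w 0 ≤ w 1 ↔ v 1 ≤ v 0) ∧ (w 1 ≤ w 0 ↔ v 0 ≤ v 1)) := by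
      have h₁ := hw.2.2
      have h₂ := hv.2.2
      simp only [Perp] at hPw hPv
      grind
    rcases hcases with ⟨h₀, h₁⟩ | ⟨h₀, h₁⟩
    · obtain ⟨m, hm, hmw⟩ := hauto w v hw hv h₀ h₁
      refine ⟨l⁻¹ * m, G.mul_mem (G.inv_mem hmem) hm, fun i => ?_⟩
      simp [hmw, ← huv]
    · obtain ⟨m, hm, hmw⟩ := hauto w _ hw (hswap v hv) h₀ h₁
      obtain ⟨n, hn, hnu⟩ := hauto _ u (hswap u hu) hu (iff_of_false hPu.2 hPu.1)
        (iff_of_false hPu.1 hPu.2)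
      refine ⟨n * (l⁻¹ * m), G.mul_mem hn (G.mul_mem (G.inv_mem hmem) hm), fun i => ?_⟩
      rw [← hnu i]
      simp [hmw, ← huv]
  intro a b ha hb
  obtain ⟨ga, hga, hna, -⟩ := hnorm a ha
  obtain ⟨gb, hgb, hnb, -⟩ := hnorm b hb
  obtain ⟨ma, hma, hmau⟩ := hall _ hna
  obtain ⟨mb, hmb, hmbu⟩ := hall _ hnb
  refine ⟨(mb * gb)⁻¹ * (ma * ga),
    G.mul_mem (G.inv_mem (G.mul_mem hmb hgb)) (G.mul_mem hma hga), fun i => ?_⟩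
  rw [Equiv.Perm.mul_apply, Equiv.Perm.inv_eq_iff_eq]
  simp [hmau, hmbu]
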